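/- arXiv:2203.09342 — 7 statements merged into one kernel-verified Lean document; each statement's English description precedes it below -/
import Mathlib

section
/- Assume n ≥ 2 and let G₂ be the subgroup of S_n generated by the transposition Equiv.swap 0 1. Then an element of A_f is both S_n-invariant and a trivial G₂-invariant if and only if it lies in the image of algebraMap A A_f. -/
open MvPolynomial

noncomputable section

/-- The ideal defining the splitting algebra of `f = Xⁿ + a₁Xⁿ⁻¹ + ⋯ + aₙ`. -/
def splittingIdeal (A : Type*) [CommRing A] (n : ℕ) (a : Fin n → A) :
    Ideal (MvPolynomial (Fin n) A) :=
  Ideal.span (Set.range fun k : Fin n =>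
    esymm (Fin n) A (k.1 + 1) - C ((-1 : A) ^ (k.1 + 1) * a k))

/-- The splitting algebra `A_f`. -/
abbrev SplittingAlg (A : Type*) [CommRing A] (n : ℕ) (a : Fin n → A) : Type _ :=
  MvPolynomial (Fin n) A ⧸ splittingIdeal A n a

/-- The quotient map `π`. -/
def splittingMk (A : Type*) [CommRing A] (n : ℕ) (a : Fin n → A) :
    MvPolynomial (Fin n) A →ₐ[A] SplittingAlg A n a :=
  Ideal.Quotient.mkₐ A (splittingIdeal A n a)

/-- The universal roots `τᵢ`. -/
def tau (A : Type*) [CommRing A] (n : ℕ) (a : Fin n → A) (i : Fin n) :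
    SplittingAlg A n a :=
  splittingMk A n a (X i)

theorem rename_mem_splittingIdeal (A : Type*) [CommRing A] (n : ℕ) (a : Fin n → A)
    (σ : Equiv.Perm (Fin n)) {p : MvPolynomial (Fin n) A}
    (hp : p ∈ splittingIdeal A n a) :
    rename (σ : Fin n → Fin n) p ∈ splittingIdeal A n a := by
  have h : (splittingIdeal A n a).map ((rename (σ : Fin n → Fin n)).toRingHom :
      MvPolynomial (Fin n) A →+* MvPolynomial (Fin n) A) ≤ splittingIdeal A n a := by
    rw [splittingIdeal, Ideal.map_span]
    refine Ideal.span_le.2 ?_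
    rintro _ ⟨_, ⟨k, rfl⟩, rfl⟩
    have hren : (rename (σ : Fin n → Fin n))
        (esymm (Fin n) A (k.1 + 1) - C ((-1 : A) ^ (k.1 + 1) * a k))
        = esymm (Fin n) A (k.1 + 1) - C ((-1 : A) ^ (k.1 + 1) * a k) := by
      rw [map_sub, esymm_isSymmetric (Fin n) A (k.1 + 1) σ, rename_C]
    show (rename (σ : Fin n → Fin n))
        (esymm (Fin n) A (k.1 + 1) - C ((-1 : A) ^ (k.1 + 1) * a k)) ∈ _
    rw [hren]
    exact Ideal.subset_span ⟨k, rfl⟩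
  exact h (Ideal.mem_map_of_mem _ hp)

/-- The action of a permutation `σ` on the splitting algebra, as an `A`-algebra map. -/
def permHom (A : Type*) [CommRing A] (n : ℕ) (a : Fin n → A) (σ : Equiv.Perm (Fin n)) :
    SplittingAlg A n a →ₐ[A] SplittingAlg A n a :=
  Ideal.Quotient.liftₐ (splittingIdeal A n a)
    ((splittingMk A n a).comp (rename (σ : Fin n → Fin n)))
    (fun p hp => by
      have h := rename_mem_splittingIdeal A n a σ hp
      show Ideal.Quotient.mkₐ A (splittingIdeal A n a) _ = 0
      rw [Ideal.Quotient.mkₐ_eq_mk]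
      exact (Ideal.Quotient.eq_zero_iff_mem).2 h)

/-- The trivial `G`-invariants of the splitting algebra. -/
def trivialInv (A : Type*) [CommRing A] (n : ℕ) (a : Fin n → A)
    (G : Subgroup (Equiv.Perm (Fin n))) : Set (SplittingAlg A n a) :=
  splittingMk A n a '' {p | ∀ σ ∈ G, rename (σ : Fin n → Fin n) p = p}

/-- The element `D_f = ∏_{i<j} (τᵢ + τⱼ)`. -/
def Df (A : Type*) [CommRing A] (n : ℕ) (a : Fin n → A) : SplittingAlg A n a :=
  ∏ p ∈ Finset.univ.filter (fun p : Fin n × Fin n => p.1 < p.2),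
    (tau A n a p.1 + tau A n a p.2)

end

universe u

/-- Over `AdjoinRoot g`, the monic polynomial `g` splits off the linear factor of its root. -/
theorem exists_factor_adjoinRoot {B : Type*} [CommRing B] [Nontrivial B] (g : Polynomial B)
    (hg : g.Monic) (hd : 0 < g.natDegree) :
    Function.Injective (AdjoinRoot.of g) ∧
    ∃ h : Polynomial (AdjoinRoot g), h.Monic ∧ h.natDegree = g.natDegree - 1 ∧
      g.map (AdjoinRoot.of g) = (Polynomial.X - Polynomial.C (AdjoinRoot.root g)) * h := by
  have hinj : Function.Injective (AdjoinRoot.of g) := by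
    rw [injective_iff_map_eq_zero]
    intro b hb
    by_contra hne
    refine hg.not_dvd_of_degree_lt (q := Polynomial.C b) (by simpa using hne) ?_
      (AdjoinRoot.mk_eq_zero.1 hb)
    exact Polynomial.degree_C_le.trans_lt (Polynomial.natDegree_pos_iff_degree_pos.1 hd)
  have : Nontrivial (AdjoinRoot g) := hinj.nontrivial
  have hfac := Polynomial.mul_divByMonic_eq_iff_isRoot.2 (AdjoinRoot.isRoot_root g)
  refine ⟨hinj, _, ?_, ?_, hfac.symm⟩
  · exact (Polynomial.monic_X_sub_C _).of_mul_monic_left (hfac ▸ hg.map _)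
  · rw [Polynomial.natDegree_divByMonic _ (Polynomial.monic_X_sub_C _), hg.natDegree_map]
    simp

/-- The monic polynomial `Xⁿ + a₁Xⁿ⁻¹ + ⋯ + aₙ`. -/
noncomputable def splittingPoly (A : Type*) [CommRing A] (n : ℕ) (a : Fin n → A) : Polynomial A :=
  Polynomial.X ^ n + ∑ k : Fin n, Polynomial.C (a k) * Polynomial.X ^ (n - (k.1 + 1))

theorem coeff_splittingPoly (A : Type*) [CommRing A] (n : ℕ) (a : Fin n → A) (k : Fin n) :
    (splittingPoly A n a).coeff (n - (k.1 + 1)) = a k := by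
  have hk := k.2
  simp only [splittingPoly, Polynomial.coeff_add, Polynomial.coeff_X_pow,
    Polynomial.finsetSum_coeff, Polynomial.coeff_C_mul]
  rw [if_neg (by omega), Finset.sum_eq_single k]
  · simp
  · intro b _ hb
    have := b.2
    have hne : b.1 ≠ k.1 := fun h => hb (Fin.ext h)
    rw [if_neg (by omega), mul_zero]
  · simp

/-- Vieta's formulas for `splittingPoly`. -/
theorem map_splittingPoly_eq_prod_iff {A T : Type*} [CommRing A] [CommRing T] {n : ℕ}
    (a : Fin n → A) (ρ : A →+* T) (t : Fin n → T) :
    (splittingPoly A n a).map ρ = ∏ i, (Polynomial.X - Polynomial.C (t i)) ↔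
      ∀ k : Fin n, (Finset.univ.val.map t).esymm (k.1 + 1) = (-1) ^ (k.1 + 1) * ρ (a k) := by
  have hprod : ∏ i, (Polynomial.X - Polynomial.C (t i)) =
      ((Finset.univ.val.map t).map fun x => Polynomial.X - Polynomial.C x).prod := by
    rw [Multiset.map_map]; rfl
  have hcard : Multiset.card (Finset.univ.val.map t) = n := by simp
  have hsq : ∀ (m : ℕ) (x : T), (-1) ^ m * ((-1) ^ m * x) = x := fun m x => by
    rw [← mul_assoc, ← mul_pow]; simp
  constructor
  · intro h k
    have hk := k.2
    have h1 := congrArg (fun p => p.coeff (n - (k.1 + 1))) h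
    simp only [Polynomial.coeff_map, coeff_splittingPoly] at h1
    rw [hprod, Multiset.prod_X_sub_C_coeff _ (by rw [hcard]; omega), hcard,
      show n - (n - (k.1 + 1)) = k.1 + 1 by omega] at h1
    rw [h1, hsq]
  · intro h
    rw [hprod, Multiset.prod_X_sub_X_eq_sum_esymm, hcard, Finset.sum_range_succ', add_comm,
      Finset.sum_range]
    simp only [h, splittingPoly, Polynomial.map_add, Polynomial.map_pow, Polynomial.map_X,
      Polynomial.map_sum, Polynomial.map_mul, Polynomial.map_C]
    congr 1
    · simp [Multiset.esymm]
    · refine Finset.sum_congr rfl fun k _ => ?_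
      rw [Polynomial.C_mul, ← mul_assoc, ← mul_assoc, Polynomial.C_pow, Polynomial.C_neg,
        Polynomial.C_1, ← mul_pow]
      simp

theorem map_splittingPoly_eq_prod_tau (A : Type*) [CommRing A] (n : ℕ) (a : Fin n → A) :
    (splittingPoly A n a).map (algebraMap A (SplittingAlg A n a)) =
      ∏ i, (Polynomial.X - Polynomial.C (tau A n a i)) := by
  rw [map_splittingPoly_eq_prod_iff]
  intro k
  have haev : aeval (tau A n a) = splittingMk A n a := by
    ext i; simp [tau]
  rw [← aeval_esymm_eq_multiset_esymm (Fin n) A, haev]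
  have hmem : esymm (Fin n) A (k.1 + 1) - C ((-1 : A) ^ (k.1 + 1) * a k) ∈
      splittingIdeal A n a := Ideal.subset_span ⟨k, rfl⟩
  have h0 : splittingMk A n a
      (esymm (Fin n) A (k.1 + 1) - C ((-1 : A) ^ (k.1 + 1) * a k)) = 0 :=
    Ideal.Quotient.eq_zero_iff_mem.2 hmem
  rw [map_sub, sub_eq_zero] at h0
  rw [h0, ← MvPolynomial.algebraMap_eq, AlgHom.commutes]
  simp

/-- The universal property of the splitting algebra. -/
theorem exists_splittingAlg_lift {A T : Type*} [CommRing A] [CommRing T] {n : ℕ}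
    (a : Fin n → A) (ρ : A →+* T) (t : Fin n → T)
    (h : (splittingPoly A n a).map ρ = ∏ i, (Polynomial.X - Polynomial.C (t i))) :
    ∃ φ : SplittingAlg A n a →+* T,
      (∀ r, φ (algebraMap A _ r) = ρ r) ∧ ∀ i, φ (tau A n a i) = t i := by
  let := ρ.toAlgebra
  rw [map_splittingPoly_eq_prod_iff] at h
  have hle : splittingIdeal A n a ≤ RingHom.ker (aeval t : MvPolynomial (Fin n) A →ₐ[A] T) := by
    refine Ideal.span_le.2 ?_
    rintro _ ⟨k, rfl⟩
    rw [SetLike.mem_coe, RingHom.mem_ker, map_sub, aeval_esymm_eq_multiset_esymm, h, aeval_C,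
      RingHom.algebraMap_toAlgebra]
    simp
  let φ := Ideal.Quotient.liftₐ (splittingIdeal A n a) (aeval t : MvPolynomial (Fin n) A →ₐ[A] T)
    fun p hp => hle hp
  refine ⟨φ, fun r => φ.commutes r, fun i => ?_⟩
  change aeval t (X i) = t i
  simp

/-- Every monic polynomial splits into linear factors over some extension ring. -/
theorem exists_injective_map_eq_prod_X_sub_C {ι : Type*} [DecidableEq ι] (s : Finset ι) :
    ∀ {B : Type u} [CommRing B] (g : Polynomial B), g.Monic → g.natDegree = s.card →
    ∃ (T : Type u) (_ : CommRing T) (φ : B →+* T) (t : ι → T), Function.Injective φ ∧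
      g.map φ = ∏ i ∈ s, (Polynomial.X - Polynomial.C (t i)) := by
  induction s using Finset.induction_on with
  | empty =>
    intro B _ g hg hd
    refine ⟨B, inferInstance, RingHom.id B, fun _ => 0, Function.injective_id, ?_⟩
    simp [Polynomial.eq_one_of_monic_natDegree_zero hg (by simpa using hd)]
  | insert j s hj ih =>
    intro B _ g hg hd
    rcases subsingleton_or_nontrivial B with hB | hB
    · exact ⟨B, inferInstance, RingHom.id B, fun _ => 0, Function.injective_id,
        Subsingleton.elim _ _⟩
    obtain ⟨hinj, h, hm, hdeg, hfac⟩ := exists_factor_adjoinRoot g hg (by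
      rw [hd, Finset.card_insert_of_notMem hj]; omega)
    obtain ⟨T, _, φ, t, hφ, hmap⟩ := ih h hm (by
      rw [hdeg, hd, Finset.card_insert_of_notMem hj]; omega)
    refine ⟨T, inferInstance, φ.comp (AdjoinRoot.of g),
      Function.update t j (φ (AdjoinRoot.root g)), hφ.comp hinj, ?_⟩
    rw [← Polynomial.map_map, hfac, Polynomial.map_mul, hmap, Finset.prod_insert hj]
    congr 1
    · simp
    · refine Finset.prod_congr rfl fun i hi => ?_
      rw [Function.update_of_ne (by rintro rfl; exact hj hi)]

/-- The subalgebra of `A_f` generated by the universal roots with index in `t`. -/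
noncomputable def rootSubalgebra (A : Type*) [CommRing A] (n : ℕ) (a : Fin n → A) (t : Finset (Fin n)) :
    Subalgebra A (SplittingAlg A n a) :=
  Algebra.adjoin A (tau A n a '' t)

theorem tau_mem_rootSubalgebra {A : Type*} [CommRing A] {n : ℕ} (a : Fin n → A)
    {t : Finset (Fin n)} {i : Fin n} (hi : i ∈ t) : tau A n a i ∈ rootSubalgebra A n a t :=
  Algebra.subset_adjoin ⟨i, hi, rfl⟩

theorem rootSubalgebra_mono {A : Type*} [CommRing A] {n : ℕ} (a : Fin n → A)
    {s t : Finset (Fin n)} (h : s ⊆ t) : rootSubalgebra A n a s ≤ rootSubalgebra A n a t :=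
  Algebra.adjoin_mono (Set.image_mono (by simpa using h))

/-- Ring homomorphisms out of `rootSubalgebra A n a t` are determined by their values on `A` and
on the roots with index in `t`. -/
theorem ringHom_rootSubalgebra_ext {A T : Type*} [CommRing A] [CommRing T] {n : ℕ}
    {a : Fin n → A} {t : Finset (Fin n)} {φ ψ : rootSubalgebra A n a t →+* T}
    (hA : ∀ r, φ (algebraMap A _ r) = ψ (algebraMap A _ r))
    (ht : ∀ i (hi : i ∈ t), φ ⟨tau A n a i, tau_mem_rootSubalgebra a hi⟩ =
      ψ ⟨tau A n a i, tau_mem_rootSubalgebra a hi⟩) : φ = ψ := by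
  ext ⟨x, hx⟩
  refine Algebra.adjoin_induction (p := fun y hy => φ ⟨y, hy⟩ = ψ ⟨y, hy⟩)
    ?_ hA ?_ ?_ hx
  · rintro _ ⟨i, hi, rfl⟩
    exact ht i hi
  · intro y z hy hz h1 h2
    exact (φ.map_add ⟨y, hy⟩ ⟨z, hz⟩).trans
      ((congrArg₂ (· + ·) h1 h2).trans (ψ.map_add ⟨y, hy⟩ ⟨z, hz⟩).symm)
  · intro y z hy hz h1 h2
    exact (φ.map_mul ⟨y, hy⟩ ⟨z, hz⟩).trans
      ((congrArg₂ (· * ·) h1 h2).trans (ψ.map_mul ⟨y, hy⟩ ⟨z, hz⟩).symm)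

theorem mem_lifts_rootSubalgebra_iff {A : Type*} [CommRing A] {n : ℕ} {a : Fin n → A}
    {t : Finset (Fin n)} {p : Polynomial (SplittingAlg A n a)} :
    p ∈ Polynomial.lifts (algebraMap (rootSubalgebra A n a t) (SplittingAlg A n a)) ↔
      ∀ i, p.coeff i ∈ rootSubalgebra A n a t := by
  rw [Polynomial.lifts_iff_coeff_lifts]
  refine forall_congr' fun i => ⟨?_, fun h => ⟨⟨_, h⟩, rfl⟩⟩
  rintro ⟨y, hy⟩
  exact hy ▸ y.2

/-- The monic polynomial whose roots are the universal roots with index outside of `t`. -/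
noncomputable def residualPoly (A : Type*) [CommRing A] (n : ℕ) (a : Fin n → A)
    (t : Finset (Fin n)) : Polynomial (SplittingAlg A n a) :=
  ∏ i ∈ tᶜ, (Polynomial.X - Polynomial.C (tau A n a i))

theorem monic_residualPoly {A : Type*} [CommRing A] {n : ℕ} (a : Fin n → A)
    (t : Finset (Fin n)) : (residualPoly A n a t).Monic :=
  Polynomial.monic_prod_of_monic _ _ fun _ _ => Polynomial.monic_X_sub_C _

theorem natDegree_residualPoly {A : Type*} [CommRing A] {n : ℕ} (a : Fin n → A)
    [Nontrivial (SplittingAlg A n a)] (t : Finset (Fin n)) :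
    (residualPoly A n a t).natDegree = tᶜ.card := by
  rw [residualPoly, Polynomial.natDegree_prod_of_monic _ _
    fun _ _ => Polynomial.monic_X_sub_C _]
  simp

theorem eval_residualPoly {A : Type*} [CommRing A] {n : ℕ} (a : Fin n → A)
    {t : Finset (Fin n)} {j : Fin n} (hj : j ∉ t) :
    (residualPoly A n a t).eval (tau A n a j) = 0 := by
  rw [residualPoly, Polynomial.eval_prod]
  exact Finset.prod_eq_zero (Finset.mem_compl.2 hj) (by simp)

theorem residualPoly_eq_mul {A : Type*} [CommRing A] {n : ℕ} (a : Fin n → A)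
    {t : Finset (Fin n)} {j : Fin n} (hj : j ∉ t) :
    residualPoly A n a t =
      (Polynomial.X - Polynomial.C (tau A n a j)) * residualPoly A n a (insert j t) := by
  rw [residualPoly, residualPoly, Finset.compl_insert,
    Finset.mul_prod_erase _ (fun i => Polynomial.X - Polynomial.C (tau A n a i))
      (Finset.mem_compl.2 hj)]

/-- The residual polynomial of `t` and the factorization of `f` into it and the `X - τᵢ`, `i ∈ t`,
have coefficients in the subalgebra generated by the roots with index in `t`. -/
theorem exists_residualPoly_lift {A : Type*} [CommRing A] {n : ℕ} (a : Fin n → A)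
    (t : Finset (Fin n)) :
    ∃ g : Polynomial (rootSubalgebra A n a t),
      g.map (algebraMap _ (SplittingAlg A n a)) = residualPoly A n a t ∧
      (splittingPoly A n a).map (algebraMap A _) =
        (∏ i : t, (Polynomial.X - Polynomial.C
          (⟨tau A n a i, tau_mem_rootSubalgebra a i.2⟩ : rootSubalgebra A n a t))) * g := by
  have hinj : Function.Injective
      (algebraMap (rootSubalgebra A n a t) (SplittingAlg A n a)) := Subtype.val_injective
  set q : Polynomial (rootSubalgebra A n a t) := ∏ i : t, (Polynomial.X - Polynomial.C
    (⟨tau A n a i, tau_mem_rootSubalgebra a i.2⟩ : rootSubalgebra A n a t)) with hq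
  have hqm : q.Monic := Polynomial.monic_prod_of_monic _ _ fun _ _ => Polynomial.monic_X_sub_C _
  have hqmap : q.map (algebraMap _ (SplittingAlg A n a)) =
      ∏ i ∈ t, (Polynomial.X - Polynomial.C (tau A n a i)) := by
    rw [hq, Polynomial.map_prod,
      ← Finset.prod_coe_sort t fun i => Polynomial.X - Polynomial.C (tau A n a i)]
    simp
  have hf : ((splittingPoly A n a).map (algebraMap A (rootSubalgebra A n a t))).map
      (algebraMap _ (SplittingAlg A n a)) =
      q.map (algebraMap _ (SplittingAlg A n a)) * residualPoly A n a t := by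
    rw [Polynomial.map_map, ← IsScalarTower.algebraMap_eq, map_splittingPoly_eq_prod_tau, hqmap,
      residualPoly, Finset.prod_mul_prod_compl]
  have hg : (((splittingPoly A n a).map (algebraMap A _)) /ₘ q).map
      (algebraMap _ (SplittingAlg A n a)) = residualPoly A n a t := by
    rw [Polynomial.map_divByMonic _ hqm, hf, Polynomial.mul_divByMonic_cancel_left _ (hqm.map _)]
  refine ⟨_, hg, Polynomial.map_injective _ hinj ?_⟩
  rw [hf, Polynomial.map_mul, hg]

/-- The powers `τⱼᵉ` with `e < n - #t` are linearly independent over the subalgebra generated by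
the roots with index in `t`, for `j ∉ t`. -/
theorem eq_zero_of_eval_tau_eq_zero {A : Type u} [CommRing A] {n : ℕ} {a : Fin n → A}
    {t : Finset (Fin n)} {j : Fin n} (hj : j ∉ t) {p : Polynomial (SplittingAlg A n a)}
    (hp : ∀ i, p.coeff i ∈ rootSubalgebra A n a t) (hdeg : p.degree < tᶜ.card)
    (h0 : p.eval (tau A n a j) = 0) : p = 0 := by
  rcases subsingleton_or_nontrivial (SplittingAlg A n a) with hS | hS
  · exact Subsingleton.elim _ _
  have hinj : Function.Injective
      (algebraMap (rootSubalgebra A n a t) (SplittingAlg A n a)) := Subtype.val_injective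
  obtain ⟨g, hg, hfg⟩ := exists_residualPoly_lift a t
  have hgm : g.Monic := Polynomial.monic_of_injective hinj (hg ▸ monic_residualPoly a t)
  have hgd : g.natDegree = tᶜ.card := by
    rw [← Polynomial.natDegree_map_eq_of_injective hinj, hg, natDegree_residualPoly]
  have hjc : j ∈ tᶜ := Finset.mem_compl.2 hj
  have hpos : 0 < tᶜ.card := Finset.card_pos.2 ⟨j, hjc⟩
  obtain ⟨q, hq⟩ := (Polynomial.mem_lifts _).1 (mem_lifts_rootSubalgebra_iff.2 hp)
  obtain ⟨-, h, hm, hd, hfac⟩ := exists_factor_adjoinRoot g hgm (by omega)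
  obtain ⟨T, _, φ, r, hφ, hmap⟩ := exists_injective_map_eq_prod_X_sub_C (tᶜ.erase j) h hm
    (by rw [hd, hgd, Finset.card_erase_of_mem hjc])
  let root : Fin n → T := fun i =>
    if hi : i ∈ t then
      φ (AdjoinRoot.of g (⟨tau A n a i, tau_mem_rootSubalgebra a hi⟩ : rootSubalgebra A n a t))
    else if i = j then φ (AdjoinRoot.root g) else r i
  have hroot : root j = φ (AdjoinRoot.root g) := by simp [root, hj]
  have hsplit : (splittingPoly A n a).map
      ((φ.comp (AdjoinRoot.of g)).comp (algebraMap A (rootSubalgebra A n a t))) =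
      ∏ i, (Polynomial.X - Polynomial.C (root i)) := by
    rw [← Polynomial.map_map, hfg, Polynomial.map_mul, ← Finset.prod_mul_prod_compl t,
      ← Polynomial.map_map (AdjoinRoot.of g) φ g, hfac, Polynomial.map_mul, hmap,
      Polynomial.map_prod,
      ← Finset.mul_prod_erase _ _ hjc, ← Finset.prod_coe_sort t]
    congr 1
    · refine Finset.prod_congr rfl fun i _ => ?_
      simp [root]
    · congr 1
      · simp [hroot]
      · refine Finset.prod_congr rfl fun i hi => ?_
        rw [Finset.mem_erase, Finset.mem_compl] at hi
        simp [root, hi.1, hi.2]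
  obtain ⟨ψ, hψA, hψ⟩ := exists_splittingAlg_lift a _ root hsplit
  have hcomp : ψ.comp (algebraMap (rootSubalgebra A n a t) (SplittingAlg A n a)) =
      φ.comp (AdjoinRoot.of g) := by
    refine ringHom_rootSubalgebra_ext (fun c => ?_) fun i hi => ?_
    · exact hψA c
    · refine (hψ i).trans ?_
      simp [root, hi]
  have hzero : φ (AdjoinRoot.mk g q) = 0 := by
    have h1 := congrArg ψ h0
    rw [← hq, Polynomial.eval_map, Polynomial.hom_eval₂, hcomp, hψ, hroot, map_zero,
      ← Polynomial.hom_eval₂] at h1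
    rwa [← AdjoinRoot.aeval_eq, Polynomial.aeval_def, AdjoinRoot.algebraMap_eq]
  have hdvd : g ∣ q := AdjoinRoot.mk_eq_zero.1 (hφ (hzero.trans (map_zero φ).symm))
  by_contra hne
  refine hgm.not_dvd_of_degree_lt (q := q) (fun h => hne (by rw [← hq, h, Polynomial.map_zero]))
    ?_ hdvd
  rw [Polynomial.degree_eq_natDegree hgm.ne_zero, hgd,
    ← Polynomial.degree_map_eq_of_injective hinj, hq]
  exact hdeg

theorem permHom_tau {A : Type*} [CommRing A] {n : ℕ} (a : Fin n → A) (σ : Equiv.Perm (Fin n))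
    (i : Fin n) : permHom A n a σ (tau A n a i) = tau A n a (σ i) := by
  change splittingMk A n a (rename σ (X i)) = _
  rw [rename_X, tau]

/-- Every element of `A_f` generated by the roots in `insert j t` is a polynomial in `τⱼ` of
degree less than `n - #t` with coefficients generated by the roots in `t`. -/
theorem exists_eval_tau_eq {A : Type*} [CommRing A] {n : ℕ} {a : Fin n → A}
    [Nontrivial (SplittingAlg A n a)] {t : Finset (Fin n)} {j : Fin n} (hj : j ∉ t)
    {x : SplittingAlg A n a} (hx : x ∈ rootSubalgebra A n a (insert j t)) :
    ∃ p : Polynomial (SplittingAlg A n a), (∀ i, p.coeff i ∈ rootSubalgebra A n a t) ∧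
      p.degree < tᶜ.card ∧ p.eval (tau A n a j) = x := by
  have hinj : Function.Injective
      (algebraMap (rootSubalgebra A n a t) (SplittingAlg A n a)) := Subtype.val_injective
  obtain ⟨q, hq⟩ : ∃ q : Polynomial (rootSubalgebra A n a t),
      Polynomial.aeval (tau A n a j) q = x := by
    refine Algebra.adjoin_induction
      (p := fun y _ => ∃ q : Polynomial (rootSubalgebra A n a t),
        Polynomial.aeval (tau A n a j) q = y) ?_ ?_ ?_ ?_ hx
    · rintro _ ⟨i, hi, rfl⟩
      rcases Finset.mem_insert.1 (Finset.mem_coe.1 hi) with rfl | hi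
      · exact ⟨Polynomial.X, Polynomial.aeval_X _⟩
      · exact ⟨Polynomial.C ⟨tau A n a i, tau_mem_rootSubalgebra a hi⟩, Polynomial.aeval_C _ _⟩
    · exact fun r => ⟨Polynomial.C (algebraMap A _ r), Polynomial.aeval_C _ _⟩
    · rintro y z - - ⟨q, rfl⟩ ⟨r, rfl⟩
      exact ⟨q + r, map_add _ _ _⟩
    · rintro y z - - ⟨q, rfl⟩ ⟨r, rfl⟩
      exact ⟨q * r, map_mul _ _ _⟩
  obtain ⟨g, hg, -⟩ := exists_residualPoly_lift a t
  have hgm : g.Monic := Polynomial.monic_of_injective hinj (hg ▸ monic_residualPoly a t)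
  refine ⟨(q %ₘ g).map (algebraMap _ _),
    mem_lifts_rootSubalgebra_iff.1 ((Polynomial.mem_lifts _).2 ⟨_, rfl⟩), ?_, ?_⟩
  · rw [Polynomial.map_modByMonic _ hgm, hg, ← natDegree_residualPoly a t,
      ← Polynomial.degree_eq_natDegree (monic_residualPoly a t).ne_zero]
    exact Polynomial.degree_modByMonic_lt _ (monic_residualPoly a t)
  · have h0 := eval_residualPoly a hj
    rw [← hg, Polynomial.eval_map_algebraMap] at h0
    rw [Polynomial.eval_map_algebraMap, Polynomial.aeval_modByMonic_eq_self_of_root h0, hq]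

theorem permHom_swap_eval_tau {A : Type*} [CommRing A] {n : ℕ} {a : Fin n → A}
    {t : Finset (Fin n)} {j k : Fin n} (hj : j ∉ t) (hk : k ∉ t)
    {p : Polynomial (SplittingAlg A n a)} (hp : ∀ i, p.coeff i ∈ rootSubalgebra A n a t) :
    permHom A n a (Equiv.swap j k) (p.eval (tau A n a j)) = p.eval (tau A n a k) := by
  obtain ⟨q, rfl⟩ := (Polynomial.mem_lifts _).1 (mem_lifts_rootSubalgebra_iff.2 hp)
  have hcomp : (permHom A n a (Equiv.swap j k) : SplittingAlg A n a →+* SplittingAlg A n a).comp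
      (algebraMap (rootSubalgebra A n a t) _) = algebraMap _ _ := by
    refine ringHom_rootSubalgebra_ext (fun c => ?_) fun i hi => ?_
    · exact (permHom A n a (Equiv.swap j k)).commutes c
    · refine (permHom_tau a _ i).trans ?_
      rw [Equiv.swap_apply_of_ne_of_ne (by rintro rfl; exact hj hi) (by rintro rfl; exact hk hi)]
      rfl
  rw [Polynomial.eval_map, Polynomial.eval_map, ← RingHom.coe_coe, Polynomial.hom_eval₂, hcomp,
    RingHom.coe_coe, permHom_tau, Equiv.swap_apply_left]

/-- An element generated by the roots in `insert j t` and fixed by a transposition of `j` with an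
index outside of `t` is generated by the roots in `t`, as long as `t` omits at least three
indices. -/
theorem mem_rootSubalgebra_of_permHom_swap_eq {A : Type u} [CommRing A] {n : ℕ} {a : Fin n → A}
    {t : Finset (Fin n)} {j k : Fin n} (hj : j ∉ t) (hk : k ∉ t) (hjk : k ≠ j)
    (hcard : 3 ≤ tᶜ.card) {x : SplittingAlg A n a}
    (hx : x ∈ rootSubalgebra A n a (insert j t))
    (hswap : permHom A n a (Equiv.swap j k) x = x) : x ∈ rootSubalgebra A n a t := by
  rcases subsingleton_or_nontrivial (SplittingAlg A n a) with hS | hS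
  · exact Subsingleton.elim 0 x ▸ zero_mem _
  obtain ⟨p, hp, hdeg, rfl⟩ := exists_eval_tau_eq hj hx
  rw [permHom_swap_eval_tau hj hk hp] at hswap
  set x := p.eval (tau A n a j) with hxp
  obtain ⟨m, hm⟩ : ∃ m, tᶜ.card = m + 3 := ⟨_, (Nat.sub_add_cancel hcard).symm⟩
  have hcoeff : ∀ (s : Finset (Fin n)) i,
      (residualPoly A n a s).coeff i ∈ rootSubalgebra A n a s := fun s => by
    obtain ⟨g, hg, -⟩ := exists_residualPoly_lift a s
    exact mem_lifts_rootSubalgebra_iff.1 ((Polynomial.mem_lifts _).2 ⟨g, hg⟩)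
  have hle := rootSubalgebra_mono a (Finset.subset_insert j t)
  have hkc : k ∉ insert j t := by simp [hjk, hk]
  have hcard' : (insert j t)ᶜ.card = m + 2 := by
    rw [Finset.compl_insert, Finset.card_erase_of_mem (Finset.mem_compl.2 hj), hm]
    rfl
  set b := p.coeff (m + 2) with hb
  have hlin : p - Polynomial.C x - Polynomial.C b * residualPoly A n a (insert j t) = 0 := by
    refine eq_zero_of_eval_tau_eq_zero hkc (fun i => ?_) ?_ ?_
    · rw [Polynomial.coeff_sub, Polynomial.coeff_sub, Polynomial.coeff_C_mul, Polynomial.coeff_C]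
      refine sub_mem (sub_mem (hle (hp i)) ?_) (mul_mem (hle (hp _)) (hcoeff _ i))
      split_ifs
      · exact hx
      · exact zero_mem _
    · rw [hcard', Polynomial.degree_lt_iff_coeff_zero]
      intro i hi
      have hmon := monic_residualPoly a (insert j t)
      have hnd := natDegree_residualPoly a (insert j t)
      rw [hcard'] at hnd
      rw [Polynomial.coeff_sub, Polynomial.coeff_sub, Polynomial.coeff_C_mul,
        Polynomial.coeff_C_of_ne_zero (by omega)]
      rcases hi.eq_or_lt with rfl | hi
      · have := hmon.coeff_natDegree
        rw [hnd] at this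
        rw [this]
        simp [hb]
      · rw [Polynomial.coeff_eq_zero_of_natDegree_lt (p := residualPoly A n a (insert j t))
          (by omega), Polynomial.coeff_eq_zero_of_degree_lt (p := p)
          (hdeg.trans_le (by rw [hm]; exact_mod_cast hi))]
        simp
    · simp [hswap, eval_residualPoly a hkc]
  have hmul : (Polynomial.X - Polynomial.C (tau A n a j)) * (p - Polynomial.C x) =
      Polynomial.C b * residualPoly A n a t := by
    rw [residualPoly_eq_mul a hj, sub_eq_zero.1 hlin]
    ring
  have hrel := congrArg (fun q => q.coeff (m + 2)) hmul
  simp only [sub_mul, Polynomial.coeff_sub, Polynomial.coeff_X_mul, Polynomial.coeff_C_mul] at hrel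
  rw [Polynomial.coeff_C_of_ne_zero (by omega), Polynomial.coeff_C_of_ne_zero (by omega)] at hrel
  have hb0 : b = 0 := by
    have hr : Polynomial.C (p.coeff (m + 1) - b * (residualPoly A n a t).coeff (m + 2)) -
        Polynomial.C b * Polynomial.X = 0 := by
      refine eq_zero_of_eval_tau_eq_zero hj (fun i => ?_) ?_ ?_
      · rw [Polynomial.coeff_sub, Polynomial.coeff_C_mul, Polynomial.coeff_C, Polynomial.coeff_X]
        have h1 := sub_mem (hp (m + 1)) (mul_mem (hp (m + 2)) (hcoeff t (m + 2)))
        refine sub_mem ?_ (mul_mem (hp _) ?_)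
        · split_ifs
          · exact h1
          · exact zero_mem _
        · split_ifs
          · exact one_mem _
          · exact zero_mem _
      · rw [hm, Polynomial.degree_lt_iff_coeff_zero]
        intro i hi
        rw [Polynomial.coeff_sub, Polynomial.coeff_C_mul, Polynomial.coeff_C, Polynomial.coeff_X,
          if_neg (by omega), if_neg (by omega)]
        simp
      · simp only [Polynomial.eval_sub, Polynomial.eval_C, Polynomial.eval_mul, Polynomial.eval_X]
        linear_combination hrel
    simpa using congrArg (fun q => q.coeff 1) hr
  have hpx : p = Polynomial.C x := by
    rw [hb0, Polynomial.C_0, zero_mul, sub_zero] at hlin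
    exact sub_eq_zero.1 hlin
  have h0 := hp 0
  rwa [hpx, Polynomial.coeff_C_zero] at h0

theorem mem_range_algebraMap_of_mem_rootSubalgebra {A : Type u} [CommRing A] {n : ℕ}
    {a : Fin n → A} {x : SplittingAlg A n a} (hinv : ∀ σ, permHom A n a σ x = x)
    (t : Finset (Fin n)) (ht : 2 ≤ tᶜ.card) (hx : x ∈ rootSubalgebra A n a t) :
    x ∈ Set.range (algebraMap A (SplittingAlg A n a)) := by
  induction t using Finset.induction_on with
  | empty =>
    rw [rootSubalgebra, Finset.coe_empty, Set.image_empty, Algebra.adjoin_empty] at hx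
    exact Algebra.mem_bot.1 hx
  | insert j t hj ih =>
    have hc := Finset.card_erase_of_mem (Finset.mem_compl.2 hj)
    rw [← Finset.compl_insert] at hc
    obtain ⟨k, hk⟩ := Finset.card_pos.1 (show 0 < (insert j t)ᶜ.card by omega)
    rw [Finset.mem_compl, Finset.mem_insert, not_or] at hk
    exact ih (by omega)
      (mem_rootSubalgebra_of_permHom_swap_eq hj hk.2 hk.1 (by omega) hx (hinv _))

theorem eq_zero_of_mul_X_sub_X_eq_zero {ι R : Type*} [CommRing R] {i j : ι} (hij : i ≠ j)
    {d : MvPolynomial ι R} (h : d * (X i - X j) = 0) : d = 0 := by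
  classical
  let φ : MvPolynomial ι R →ₐ[R] MvPolynomial ι R :=
    aeval (Function.update X i (X i + X j))
  let ψ : MvPolynomial ι R →ₐ[R] MvPolynomial ι R :=
    aeval (Function.update X i (X i - X j))
  have hψφ : ψ.comp φ = AlgHom.id R _ := by
    ext1 k
    rcases eq_or_ne k i with rfl | hk
    · simp [φ, ψ, hij.symm]
    · simp [φ, ψ, hk]
  have h1 := congrArg φ h
  have h2 : φ (X i - X j) = X i := by simp [φ, hij.symm]
  rw [map_mul, h2, map_zero] at h1
  have h3 : φ d = 0 := (isRegular_X (n := i)).right.mul_right_eq_zero_iff.1 h1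
  have h4 := congrArg ψ h3
  rw [map_zero] at h4
  exact (AlgHom.congr_fun hψφ d).symm.trans h4

/-- A polynomial symmetric in `Xᵢ` and `Xⱼ` is a polynomial in `Xᵢ + Xⱼ`, `Xᵢ * Xⱼ` and the other
variables. -/
theorem mem_adjoin_of_rename_swap_eq {ι R : Type*} [DecidableEq ι] [CommRing R] {i j : ι}
    (hij : i ≠ j) {p : MvPolynomial ι R} (hp : rename (Equiv.swap i j) p = p) :
    p ∈ Algebra.adjoin R
      ({X i + X j, X i * X j} ∪ X '' {i, j}ᶜ : Set (MvPolynomial ι R)) := by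
  set P := Algebra.adjoin R
    ({X i + X j, X i * X j} ∪ X '' {i, j}ᶜ : Set (MvPolynomial ι R)) with hP
  have hadd : X i + X j ∈ P := Algebra.subset_adjoin (by simp)
  have hmul : X i * X j ∈ P := Algebra.subset_adjoin (by simp)
  have hdec : ∀ q : MvPolynomial ι R, ∃ c ∈ P, ∃ d ∈ P, q = c + d * X i := by
    intro q
    induction q using MvPolynomial.induction_on with
    | C r => exact ⟨C r, P.algebraMap_mem r, 0, zero_mem _, by simp⟩
    | add q r hq hr =>
      obtain ⟨c, hc, d, hd, rfl⟩ := hq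
      obtain ⟨c', hc', d', hd', rfl⟩ := hr
      exact ⟨c + c', add_mem hc hc', d + d', add_mem hd hd', by ring⟩
    | mul_X q k hq =>
      obtain ⟨c, hc, d, hd, rfl⟩ := hq
      rcases eq_or_ne k i with rfl | hki
      · exact ⟨-(d * (X k * X j)), neg_mem (mul_mem hd hmul), c + d * (X k + X j),
          add_mem hc (mul_mem hd hadd), by ring⟩
      rcases eq_or_ne k j with rfl | hkj
      · exact ⟨c * (X i + X k) + d * (X i * X k), add_mem (mul_mem hc hadd) (mul_mem hd hmul),
          -c, neg_mem hc, by ring⟩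
      · have hk : X k ∈ P := Algebra.subset_adjoin (Or.inr ⟨k, by simp [hki, hkj], rfl⟩)
        exact ⟨c * X k, mul_mem hc hk, d * X k, mul_mem hd hk, by ring⟩
  have hfix : ∀ q ∈ P, rename (Equiv.swap i j) q = q := by
    intro q hq
    have hle : P ≤ AlgHom.equalizer (rename (Equiv.swap i j)) (AlgHom.id R _) := by
      refine Algebra.adjoin_le ?_
      rintro _ ((rfl | rfl) | ⟨k, hk, rfl⟩)
      · simp [add_comm]
      · simp [mul_comm]
      · simp only [Set.mem_compl_iff, Set.mem_insert_iff, Set.mem_singleton_iff, not_or] at hk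
        simp [Equiv.swap_apply_of_ne_of_ne hk.1 hk.2]
    exact hle hq
  obtain ⟨c, hc, d, hd, rfl⟩ := hdec p
  rw [map_add, map_mul, hfix c hc, hfix d hd, rename_X, Equiv.swap_apply_left] at hp
  have hd0 : d = 0 := eq_zero_of_mul_X_sub_X_eq_zero hij (by linear_combination -hp)
  simpa [hd0] using hc

theorem splittingMk_mem_rootSubalgebra {A : Type*} [CommRing A] {n : ℕ} (a : Fin n → A)
    {i j : Fin n} (hij : i ≠ j) {p : MvPolynomial (Fin n) A}
    (hp : rename (Equiv.swap i j) p = p) :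
    splittingMk A n a p ∈ rootSubalgebra A n a {i, j}ᶜ := by
  have hcompl : ({i, j} : Finset (Fin n))ᶜᶜ = {i, j} := compl_compl _
  obtain ⟨g, hg, -⟩ := exists_residualPoly_lift a {i, j}ᶜ
  have hcoeff : ∀ k, (residualPoly A n a {i, j}ᶜ).coeff k ∈ rootSubalgebra A n a {i, j}ᶜ :=
    mem_lifts_rootSubalgebra_iff.1 ((Polynomial.mem_lifts _).2 ⟨g, hg⟩)
  have hquad : residualPoly A n a {i, j}ᶜ =
      Polynomial.X ^ 2 - Polynomial.C (tau A n a i + tau A n a j) * Polynomial.X +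
        Polynomial.C (tau A n a i * tau A n a j) := by
    rw [residualPoly, hcompl, Finset.prod_pair hij, Polynomial.C_add, Polynomial.C_mul]
    ring
  have hle : Algebra.adjoin A
      ({X i + X j, X i * X j} ∪ X '' {i, j}ᶜ : Set (MvPolynomial (Fin n) A)) ≤
      (rootSubalgebra A n a {i, j}ᶜ).comap (splittingMk A n a) := by
    refine Algebra.adjoin_le ?_
    rintro _ ((rfl | rfl) | ⟨k, hk, rfl⟩)
    · have h1 := neg_mem (hcoeff 1)
      rw [hquad] at h1
      simpa [Polynomial.coeff_X, Polynomial.coeff_C, tau, add_comm] using h1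
    · have h0 := hcoeff 0
      rw [hquad] at h0
      simpa [tau] using h0
    · exact tau_mem_rootSubalgebra a (by simpa using hk)
  exact hle (mem_adjoin_of_rename_swap_eq hij hp)

/-- For `n ≥ 2` and `G₂` the subgroup generated by `Equiv.swap 0 1`, an element of
`A_f` is both `S_n`-invariant and a trivial `G₂`-invariant iff it is in the image of
`algebraMap A A_f`. -/
theorem invariant_and_trivial_swap_iff (A : Type*) [CommRing A] (n : ℕ) (hn : 2 ≤ n)
    (a : Fin n → A) (x : SplittingAlg A n a) :
    ((∀ σ : Equiv.Perm (Fin n), permHom A n a σ x = x) ∧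
      x ∈ trivialInv A n a
        (Subgroup.closure {Equiv.swap (⟨0, by omega⟩ : Fin n) ⟨1, by omega⟩})) ↔
    x ∈ Set.range (algebraMap A (SplittingAlg A n a)) := by
  have h01 : (⟨0, by omega⟩ : Fin n) ≠ ⟨1, by omega⟩ := by simp
  constructor
  · rintro ⟨hinv, p, hp, rfl⟩
    refine mem_range_algebraMap_of_mem_rootSubalgebra hinv _ ?_
      (splittingMk_mem_rootSubalgebra a h01 (hp _ (Subgroup.subset_closure rfl)))
    rw [compl_compl, Finset.card_pair h01]
  · rintro ⟨r, rfl⟩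
    refine ⟨fun σ => (permHom A n a σ).commutes r, C r, fun σ _ => rename_C _ _, ?_⟩
    exact (splittingMk A n a).commutes r
end

section
/- Let n = 2 and write p := a_1, q := a_2, so f = X² + pX + q. An element x of the splitting algebra A_f is invariant under the transposition Equiv.swap 0 1 if and only if there exist a, b ∈ A with 2·b = 0 and p·b = 0 such that x = π(C a + C b · X_1). In particular, every x ∈ A_f with 2·x = 0 and (τ_0 + τ_1)·x = 0 is invariant under Equiv.swap 0 1. -/
open MvPolynomial

theorem splittingMk_surjective (A : Type*) [CommRing A] (n : ℕ) (a : Fin n → A) :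
    Function.Surjective (splittingMk A n a) :=
  Ideal.Quotient.mkₐ_surjective A (splittingIdeal A n a)

theorem permHom_splittingMk (A : Type*) [CommRing A] (n : ℕ) (a : Fin n → A)
    (σ : Equiv.Perm (Fin n)) (p : MvPolynomial (Fin n) A) :
    permHom A n a σ (splittingMk A n a p) = splittingMk A n a (rename σ p) :=
  rfl

theorem splittingMk_C (A : Type*) [CommRing A] (n : ℕ) (a : Fin n → A) (b : A) :
    splittingMk A n a (C b) = algebraMap A (SplittingAlg A n a) b :=
  rfl

theorem splittingMk_esymm (A : Type*) [CommRing A] (n : ℕ) (a : Fin n → A) (k : Fin n) :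
    splittingMk A n a (esymm (Fin n) A (k.1 + 1)) =
      algebraMap A (SplittingAlg A n a) ((-1) ^ (k.1 + 1) * a k) := by
  rw [← splittingMk_C]
  exact Ideal.Quotient.eq.2 (Ideal.subset_span ⟨k, rfl⟩)

theorem esymm_fin_two_one (A : Type*) [CommRing A] :
    esymm (Fin 2) A 1 = X 0 + X 1 := by
  rw [esymm_one, Fin.sum_univ_two]

theorem esymm_fin_two_two (A : Type*) [CommRing A] :
    esymm (Fin 2) A 2 = X 0 * X 1 := by
  have h : Finset.powersetCard 2 (Finset.univ : Finset (Fin 2)) = {Finset.univ} :=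
    Finset.powersetCard_self _
  rw [esymm, h, Finset.sum_singleton, Fin.prod_univ_two]

theorem tau_zero_add_tau_one (A : Type*) [CommRing A] (a : Fin 2 → A) :
    tau A 2 a 0 + tau A 2 a 1 = -algebraMap A (SplittingAlg A 2 a) (a 0) := by
  have h := splittingMk_esymm A 2 a 0
  simpa [esymm_fin_two_one, tau] using h

theorem tau_zero_mul_tau_one (A : Type*) [CommRing A] (a : Fin 2 → A) :
    tau A 2 a 0 * tau A 2 a 1 = algebraMap A (SplittingAlg A 2 a) (a 1) := by
  have h := splittingMk_esymm A 2 a 1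
  simpa [esymm_fin_two_two, tau] using h

/-- The splitting algebra of `X² + pX + q` maps to `A[ω]/(ω² + pω + q)` by `τ₁ ↦ ω`. -/
noncomputable def toQuadraticAlgebra (A : Type*) [CommRing A] (a : Fin 2 → A) :
    SplittingAlg A 2 a →ₐ[A] QuadraticAlgebra A (-a 1) (-a 0) :=
  Ideal.Quotient.liftₐ (splittingIdeal A 2 a) (aeval ![⟨-a 0, -1⟩, ⟨0, 1⟩]) (by
    intro p hp
    have hle : splittingIdeal A 2 a ≤
        RingHom.ker (aeval (R := A) ![(⟨-a 0, -1⟩ : QuadraticAlgebra A (-a 1) (-a 0)),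
          ⟨0, 1⟩]) := by
      refine Ideal.span_le.2 ?_
      rintro _ ⟨k, rfl⟩
      rw [SetLike.mem_coe, RingHom.mem_ker]
      fin_cases k <;>
        ext <;> simp [esymm_fin_two_two, QuadraticAlgebra.algebraMap_eq]
    exact hle hp)

theorem toQuadraticAlgebra_tau_one (A : Type*) [CommRing A] (a : Fin 2 → A) :
    toQuadraticAlgebra A a (tau A 2 a 1) = ⟨0, 1⟩ := by
  change aeval _ (X 1) = _
  simp

theorem algebraMap_add_mul_tau_one_eq_zero_iff (A : Type*) [CommRing A] (a : Fin 2 → A)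
    (b c : A) :
    algebraMap A (SplittingAlg A 2 a) b + algebraMap A (SplittingAlg A 2 a) c * tau A 2 a 1 = 0 ↔
      b = 0 ∧ c = 0 := by
  refine ⟨fun h => ?_, fun ⟨hb, hc⟩ => by simp [hb, hc]⟩
  have h' := congrArg (toQuadraticAlgebra A a) h
  rw [map_add, map_mul, AlgHom.commutes, AlgHom.commutes, toQuadraticAlgebra_tau_one,
    map_zero] at h'
  have hre := congrArg QuadraticAlgebra.re h'
  have him := congrArg QuadraticAlgebra.im h'
  simp [QuadraticAlgebra.algebraMap_eq] at hre him
  exact ⟨hre, him⟩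

theorem exists_eq_algebraMap_add_mul_tau_one (A : Type*) [CommRing A] (a : Fin 2 → A)
    (x : SplittingAlg A 2 a) :
    ∃ b c : A, x = algebraMap A (SplittingAlg A 2 a) b +
      algebraMap A (SplittingAlg A 2 a) c * tau A 2 a 1 := by
  have hs := tau_zero_add_tau_one A a
  have hm := tau_zero_mul_tau_one A a
  obtain ⟨p, rfl⟩ := splittingMk_surjective A 2 a x
  induction p using MvPolynomial.induction_on with
  | C b => exact ⟨b, 0, by simp⟩
  | add p r hp hr =>
    obtain ⟨b, c, hp⟩ := hp
    obtain ⟨b', c', hr⟩ := hr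
    refine ⟨b + b', c + c', ?_⟩
    rw [map_add, hp, hr, map_add, map_add]
    ring
  | mul_X p i hp =>
    obtain ⟨b, c, hp⟩ := hp
    rw [map_mul, hp]
    fin_cases i
    · refine ⟨c * a 1 - b * a 0, -b, ?_⟩
      change _ * tau A 2 a 0 = _
      simp only [map_sub, map_mul, map_neg]
      linear_combination algebraMap A (SplittingAlg A 2 a) b * hs +
        algebraMap A (SplittingAlg A 2 a) c * hm
    · refine ⟨-(c * a 1), b - c * a 0, ?_⟩
      change _ * tau A 2 a 1 = _
      simp only [map_sub, map_mul, map_neg]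
      linear_combination algebraMap A (SplittingAlg A 2 a) c * tau A 2 a 1 * hs -
        algebraMap A (SplittingAlg A 2 a) c * hm

theorem permHom_swap_eq_self_iff (A : Type*) [CommRing A] (a : Fin 2 → A) (b c : A) :
    permHom A 2 a (Equiv.swap 0 1) (algebraMap A (SplittingAlg A 2 a) b +
        algebraMap A (SplittingAlg A 2 a) c * tau A 2 a 1) =
      algebraMap A (SplittingAlg A 2 a) b + algebraMap A (SplittingAlg A 2 a) c * tau A 2 a 1 ↔
      2 * c = 0 ∧ a 0 * c = 0 := by
  have hs := tau_zero_add_tau_one A a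
  have hswap : permHom A 2 a (Equiv.swap 0 1) (tau A 2 a 1) = tau A 2 a 0 := by
    rw [tau, permHom_splittingMk, rename_X, Equiv.swap_apply_right, tau]
  rw [map_add, map_mul, AlgHom.commutes, AlgHom.commutes, hswap, and_comm,
    ← algebraMap_add_mul_tau_one_eq_zero_iff A a, map_mul, map_mul, map_ofNat]
  constructor <;> intro h
  · linear_combination algebraMap A (SplittingAlg A 2 a) c * hs - h
  · linear_combination algebraMap A (SplittingAlg A 2 a) c * hs - h

/-- For `n = 2`, `f = X² + pX + q` with `p = a 0` and `q = a 1`: an element `x` of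
`A_f` is invariant under `Equiv.swap 0 1` iff `x = π (C b + C c * X 1)` for some `b c : A` with
`2·c = 0` and `p·c = 0`. In particular every `x` with `2·x = 0` and `(τ₀ + τ₁)·x = 0` is
invariant under `Equiv.swap 0 1`. -/
theorem swap_invariant_iff_deg_two (A : Type*) [CommRing A] (a : Fin 2 → A) :
    (∀ x : SplittingAlg A 2 a,
      permHom A 2 a (Equiv.swap 0 1) x = x ↔
        ∃ b c : A, 2 * c = 0 ∧ a 0 * c = 0 ∧
          x = splittingMk A 2 a (C b + C c * X 1)) ∧
    (∀ x : SplittingAlg A 2 a, 2 * x = 0 → (tau A 2 a 0 + tau A 2 a 1) * x = 0 →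
      permHom A 2 a (Equiv.swap 0 1) x = x) := by
  have hmk (b c : A) : splittingMk A 2 a (C b + C c * X 1) =
      algebraMap A (SplittingAlg A 2 a) b +
        algebraMap A (SplittingAlg A 2 a) c * tau A 2 a 1 := by
    rw [map_add, map_mul, splittingMk_C, splittingMk_C, tau]
  refine ⟨fun x => ⟨fun hx => ?_, ?_⟩, fun x h2 hp => ?_⟩
  · obtain ⟨b, c, rfl⟩ := exists_eq_algebraMap_add_mul_tau_one A a x
    obtain ⟨h2, hp⟩ := (permHom_swap_eq_self_iff A a b c).1 hx
    exact ⟨b, c, h2, hp, (hmk b c).symm⟩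
  · rintro ⟨b, c, h2, hp, rfl⟩
    rw [hmk]
    exact (permHom_swap_eq_self_iff A a b c).2 ⟨h2, hp⟩
  · obtain ⟨b, c, rfl⟩ := exists_eq_algebraMap_add_mul_tau_one A a x
    rw [tau_zero_add_tau_one] at hp
    refine (permHom_swap_eq_self_iff A a b c).2 ⟨?_, ?_⟩
    · refine ((algebraMap_add_mul_tau_one_eq_zero_iff A a (2 * b) (2 * c)).1 ?_).2
      simp only [map_mul, map_ofNat]
      linear_combination h2
    · refine ((algebraMap_add_mul_tau_one_eq_zero_iff A a (a 0 * b) (a 0 * c)).1 ?_).2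
      simp only [map_mul]
      linear_combination -hp
end

section
/- Let x ∈ A_f, let X be a nonempty finite set of permutations in S_n, and let I be an ideal of A_f such that σ·I = I (as sets) for every σ ∈ X. Set y := ∏_{σ ∈ X} σ·x. Then I ∩ Ann_{A_f}(x) = 0 if and only if I ∩ Ann_{A_f}(y) = 0, where Ann_{A_f}(z) denotes the annihilator {w ∈ A_f : w·z = 0}. -/
open MvPolynomial

theorem permHom_injective (A : Type*) [CommRing A] (n : ℕ) (a : Fin n → A)
    (σ : Equiv.Perm (Fin n)) : Function.Injective (permHom A n a σ) := by
  refine Function.LeftInverse.injective (g := permHom A n a σ⁻¹) fun z => ?_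
  obtain ⟨p, rfl⟩ := Ideal.Quotient.mk_surjective z
  change Ideal.Quotient.mk (splittingIdeal A n a)
    (rename (σ⁻¹ : Equiv.Perm (Fin n)) (rename σ p)) = _
  rw [rename_rename, ← Equiv.Perm.coe_mul, inv_mul_cancel, Equiv.Perm.coe_one, rename_id_apply]

/-- If multiplication by each factor is injective on an ideal, so is multiplication by the
product. -/
theorem Ideal.eq_zero_of_mul_prod_eq_zero {R ι : Type*} [CommRing R] (I : Ideal R)
    (s : Finset ι) (g : ι → R) (hg : ∀ i ∈ s, ∀ w ∈ I, w * g i = 0 → w = 0) :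
    ∀ w ∈ I, w * ∏ i ∈ s, g i = 0 → w = 0 := by
  classical
  induction s using Finset.induction_on with
  | empty => simp
  | insert i s hi ih =>
    intro w hw h
    rw [Finset.prod_insert hi, ← mul_assoc] at h
    exact hg i (Finset.mem_insert_self i s) w hw
      (ih (fun j hj => hg j (Finset.mem_insert_of_mem hj)) _ (I.mul_mem_right _ hw) h)

theorem Ideal.inter_ann_eq_zero_iff {R : Type*} [CommRing R] (I : Ideal R) (z : R) :
    (I : Set R) ∩ {w : R | w * z = 0} = {0} ↔ ∀ w ∈ I, w * z = 0 → w = 0 := by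
  constructor
  · intro h w hw hz
    have hmem : w ∈ (I : Set R) ∩ {w : R | w * z = 0} := ⟨hw, hz⟩
    rwa [h] at hmem
  · intro h
    ext w
    constructor
    · rintro ⟨hw, hz⟩
      exact h w hw hz
    · rintro rfl
      exact ⟨I.zero_mem, zero_mul z⟩

/-- For `x ∈ A_f`, a nonempty finite set `X` of permutations and an ideal `I` with
`σ·I = I` for all `σ ∈ X`, setting `y := ∏_{σ ∈ X} σ·x`, we have `I ∩ Ann(x) = 0` iff
`I ∩ Ann(y) = 0`. -/
theorem ideal_inter_ann_eq_zero_iff (A : Type*) [CommRing A] (n : ℕ) (hn : 1 ≤ n)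
    (a : Fin n → A) (x : SplittingAlg A n a)
    (Xs : Finset (Equiv.Perm (Fin n))) (hXs : Xs.Nonempty)
    (I : Ideal (SplittingAlg A n a))
    (hI : ∀ σ ∈ Xs, permHom A n a σ '' (I : Set (SplittingAlg A n a))
      = (I : Set (SplittingAlg A n a))) :
    ((I : Set (SplittingAlg A n a)) ∩ {w : SplittingAlg A n a | w * x = 0} = {0}) ↔
    ((I : Set (SplittingAlg A n a)) ∩
      {w : SplittingAlg A n a | w * (∏ σ ∈ Xs, permHom A n a σ x) = 0} = {0}) := by
  rw [Ideal.inter_ann_eq_zero_iff, Ideal.inter_ann_eq_zero_iff]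
  constructor
  · intro h
    refine Ideal.eq_zero_of_mul_prod_eq_zero I Xs _ fun σ hσ w hw hz => ?_
    rw [← SetLike.mem_coe, ← hI σ hσ] at hw
    obtain ⟨u, hu, rfl⟩ := hw
    rw [← map_mul] at hz
    rw [h u hu ((map_eq_zero_iff _ (permHom_injective A n a σ)).1 hz), map_zero]
  · intro h w hw hz
    obtain ⟨σ, hσ⟩ := hXs
    refine (map_eq_zero_iff _ (permHom_injective A n a σ)).1 (h _ ?_ ?_)
    · rw [← SetLike.mem_coe, ← hI σ hσ]
      exact Set.mem_image_of_mem _ hw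
    · obtain ⟨c, hc⟩ := Finset.dvd_prod_of_mem (fun τ => permHom A n a τ x) hσ
      rw [hc, ← mul_assoc, ← map_mul, hz, map_zero, zero_mul]
end

section
/- Let i < j in Fin n and let σ := Equiv.swap i j. If x is a nonzero trivial ⟨σ⟩-invariant of A_f, then x·τ_j is not a trivial ⟨σ⟩-invariant. -/
open MvPolynomial

namespace MvPolynomial

variable {ι A : Type*} [CommRing A]

theorem eq_zero_of_mul_X_sub_X_eq_zero [DecidableEq ι] {i j : ι} (hij : i ≠ j)
    {p : MvPolynomial ι A} (h : p * (X j - X i) = 0) : p = 0 := by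
  let φ : MvPolynomial ι A →ₐ[A] MvPolynomial ι A :=
    aeval fun k => if k = j then X j + X i else X k
  let ψ : MvPolynomial ι A →ₐ[A] MvPolynomial ι A :=
    aeval fun k => if k = j then X j - X i else X k
  have hψφ : ψ.comp φ = AlgHom.id A _ := by
    ext1 k
    by_cases hk : k = j
    · subst hk
      simp [φ, ψ, hij]
    · simp [φ, ψ, hk]
  have hmul : φ p * X j = 0 := by
    have := congrArg φ h
    simpa [φ, hij] using this
  have hφ : φ p = 0 := by
    ext m
    have := congrArg (coeff (m + Finsupp.single j 1)) hmul
    simpa using this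
  calc p = ψ (φ p) := (DFunLike.congr_fun hψφ p).symm
    _ = 0 := by rw [hφ, map_zero]

theorem X_sub_X_dvd_sub_rename_swap [DecidableEq ι] (i j : ι) (p : MvPolynomial ι A) :
    X j - X i ∣ p - rename (Equiv.swap i j) p := by
  have hX : Ideal.Quotient.mk (Ideal.span {(X j - X i : MvPolynomial ι A)}) (X j)
      = Ideal.Quotient.mk _ (X i) :=
    Ideal.Quotient.eq.2 (Ideal.mem_span_singleton_self _)
  have h : (Ideal.Quotient.mkₐ A (Ideal.span {(X j - X i : MvPolynomial ι A)})) =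
      (Ideal.Quotient.mkₐ A _).comp (rename (Equiv.swap i j)) := by
    ext1 k
    rcases eq_or_ne k i with rfl | hi
    · simpa using hX.symm
    rcases eq_or_ne k j with rfl | hj
    · simpa using hX
    · simp [Equiv.swap_apply_of_ne_of_ne hi hj]
  exact Ideal.mem_span_singleton.1 (Ideal.Quotient.eq.1 (DFunLike.congr_fun h p))

/-- An ideal generated by swap-invariant polynomials is stable under divided differences. -/
theorem exists_mem_sub_rename_swap_eq_mul [DecidableEq ι] (i j : ι)
    {s : Set (MvPolynomial ι A)} (hs : ∀ g ∈ s, rename (Equiv.swap i j) g = g)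
    {r : MvPolynomial ι A} (hr : r ∈ Ideal.span s) :
    ∃ d ∈ Ideal.span s, r - rename (Equiv.swap i j) r = d * (X j - X i) := by
  induction hr using Submodule.closure_induction with
  | zero => exact ⟨0, zero_mem _, by simp⟩
  | add x y _ _ hx hy =>
    obtain ⟨d, hd, hxd⟩ := hx
    obtain ⟨e, he, hye⟩ := hy
    exact ⟨d + e, add_mem hd he, by rw [map_add, add_mul, ← hxd, ← hye]; ring⟩
  | smul_mem c g hg =>
    obtain ⟨d, hd⟩ := X_sub_X_dvd_sub_rename_swap i j c
    refine ⟨d * g, Ideal.mul_mem_left _ _ (Ideal.subset_span hg), ?_⟩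
    rw [smul_eq_mul, map_mul, hs g hg, ← sub_mul, hd]
    ring

/-- If `s` consists of swap-invariant polynomials, then `1` and `X j` are independent over the
swap-invariant polynomials modulo the ideal generated by `s`. -/
theorem mem_span_of_sub_mul_X_mem_span [DecidableEq ι] {i j : ι} (hij : i ≠ j)
    {s : Set (MvPolynomial ι A)} (hs : ∀ g ∈ s, rename (Equiv.swap i j) g = g)
    {p q : MvPolynomial ι A} (hp : rename (Equiv.swap i j) p = p)
    (hq : rename (Equiv.swap i j) q = q) (h : p * X j - q ∈ Ideal.span s) :
    p ∈ Ideal.span s := by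
  obtain ⟨d, hd, hpd⟩ := exists_mem_sub_rename_swap_eq_mul i j hs h
  rw [map_sub, map_mul, hp, hq, rename_X, Equiv.swap_apply_right] at hpd
  have hpd' : p - d = 0 :=
    eq_zero_of_mul_X_sub_X_eq_zero hij (by rw [sub_mul, ← hpd]; ring)
  rwa [sub_eq_zero.1 hpd']

end MvPolynomial

/-- For `i < j` in `Fin n` and `σ := Equiv.swap i j`, if `x` is a nonzero trivial
`⟨σ⟩`-invariant of `A_f`, then `x·τ_j` is not a trivial `⟨σ⟩`-invariant. -/
theorem mul_tau_not_trivialInv (A : Type*) [CommRing A] (n : ℕ) (hn : 1 ≤ n)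
    (a : Fin n → A) (i j : Fin n) (hij : i < j) (x : SplittingAlg A n a) (hx : x ≠ 0)
    (htriv : x ∈ trivialInv A n a (Subgroup.closure {Equiv.swap i j})) :
    x * tau A n a j ∉ trivialInv A n a (Subgroup.closure {Equiv.swap i j}) := by
  rintro ⟨q, hq, hqx⟩
  obtain ⟨p, hp, rfl⟩ := htriv
  have hσ : Equiv.swap i j ∈ Subgroup.closure {Equiv.swap i j} :=
    Subgroup.subset_closure rfl
  refine hx (Ideal.Quotient.eq_zero_iff_mem.2 ?_)
  refine mem_span_of_sub_mul_X_mem_span hij.ne ?_ (hp _ hσ) (hq _ hσ) ?_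
  · rintro _ ⟨k, rfl⟩
    rw [map_sub, esymm_isSymmetric (Fin n) A (k.1 + 1) (Equiv.swap i j), rename_C]
  · rw [tau, ← map_mul] at hqx
    exact Ideal.Quotient.eq.1 hqx.symm
end

section
/- Let B := MvPolynomial (Fin n) A with variables g_1, …, g_n (indexed by Fin n), regarded as the coefficient ring of the generic monic polynomial g = X^n + g_1·X^{n−1} + … + g_n, and let J_g be the ideal of MvPolynomial (Fin n) B generated by the elements esymm_k − (−1)^k·g_k for k = 1, …, n. Then the A-algebra homomorphism Φ : MvPolynomial (Fin n) B → MvPolynomial (Fin n) A determined by sending each variable X_i to X_i and each scalar g_k to (−1)^k·esymm_k is surjective and its kernel equals J_g; consequently Φ induces an A-algebra isomorphism from the splitting algebra B_g = MvPolynomial (Fin n) B / J_g onto MvPolynomial (Fin n) A sending each universal root of g to the corresponding variable. -/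
open MvPolynomial

/-- The homomorphism `Φ` from the generic splitting algebra's ambient polynomial ring to
`MvPolynomial (Fin n) A`, sending each variable `Xᵢ` to `Xᵢ` and each scalar `g_k`
to `(-1)^k·esymm_k`. -/
noncomputable def genericPhi (A : Type*) [CommRing A] (n : ℕ) :
    MvPolynomial (Fin n) (MvPolynomial (Fin n) A) →ₐ[A] MvPolynomial (Fin n) A :=
  aevalTower
    (aeval fun k : Fin n =>
      ((-1 : MvPolynomial (Fin n) A) ^ (k.1 + 1)) * esymm (Fin n) A (k.1 + 1))
    X

theorem neg_one_pow_mul_neg_one_pow_mul {R : Type*} [Ring R] (m : ℕ) (r : R) :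
    (-1) ^ m * ((-1) ^ m * r) = r := by
  rw [← mul_assoc, ← pow_add]
  simp [← two_mul]

theorem genericPhi_X (A : Type*) [CommRing A] (n : ℕ) (i : Fin n) :
    genericPhi A n (X i) = X i :=
  aevalTower_X _ _ i

theorem genericPhi_C (A : Type*) [CommRing A] (n : ℕ) (b : MvPolynomial (Fin n) A) :
    genericPhi A n (C b) = aeval (fun k : Fin n =>
      ((-1 : MvPolynomial (Fin n) A) ^ (k.1 + 1)) * esymm (Fin n) A (k.1 + 1)) b :=
  aevalTower_C _ _ b

/-- The section of `Φ` extending scalars from `A` to the generic coefficient ring. -/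
noncomputable def genericSection (A : Type*) [CommRing A] (n : ℕ) :
    MvPolynomial (Fin n) A →ₐ[A] MvPolynomial (Fin n) (MvPolynomial (Fin n) A) :=
  aeval X

theorem genericSection_esymm (A : Type*) [CommRing A] (n k : ℕ) :
    genericSection A n (esymm (Fin n) A k) = esymm (Fin n) (MvPolynomial (Fin n) A) k := by
  simp [genericSection, esymm, map_sum, map_prod]

theorem genericPhi_genericSection (A : Type*) [CommRing A] (n : ℕ)
    (p : MvPolynomial (Fin n) A) : genericPhi A n (genericSection A n p) = p := by
  have h : (genericPhi A n).comp (genericSection A n) = AlgHom.id A _ :=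
    MvPolynomial.algHom_ext fun i => by simp [genericSection, genericPhi_X]
  exact DFunLike.congr_fun h p

theorem genericPhi_esymm (A : Type*) [CommRing A] (n k : ℕ) :
    genericPhi A n (esymm (Fin n) (MvPolynomial (Fin n) A) k) = esymm (Fin n) A k := by
  rw [← genericSection_esymm, genericPhi_genericSection]

theorem mk_genericSection_genericPhi_C_X (A : Type*) [CommRing A] (n : ℕ) (k : Fin n) :
    Ideal.Quotient.mk (splittingIdeal (MvPolynomial (Fin n) A) n fun k => X k)
        (genericSection A n (genericPhi A n (C (X k)))) =
      Ideal.Quotient.mk (splittingIdeal (MvPolynomial (Fin n) A) n fun k => X k) (C (X k)) := by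
  have hC : (C (X k) : MvPolynomial (Fin n) (MvPolynomial (Fin n) A)) =
      (-1) ^ (k.1 + 1) * C ((-1) ^ (k.1 + 1) * X k) := by
    rw [map_mul, map_pow, map_neg, map_one]
    exact (neg_one_pow_mul_neg_one_pow_mul _ _).symm
  rw [genericPhi_C, aeval_X, map_mul, genericSection_esymm, map_pow, map_neg, map_one,
    Ideal.Quotient.eq, hC, ← mul_sub]
  exact Ideal.mul_mem_left _ _ (Ideal.subset_span ⟨k, rfl⟩)

theorem mk_genericSection_genericPhi (A : Type*) [CommRing A] (n : ℕ)
    (p : MvPolynomial (Fin n) (MvPolynomial (Fin n) A)) :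
    Ideal.Quotient.mk (splittingIdeal (MvPolynomial (Fin n) A) n fun k => X k)
        (genericSection A n (genericPhi A n p)) =
      Ideal.Quotient.mk (splittingIdeal (MvPolynomial (Fin n) A) n fun k => X k) p := by
  induction p using MvPolynomial.induction_on with
  | C b =>
    induction b using MvPolynomial.induction_on with
    | C a =>
      congr 1
      rw [genericPhi_C, aeval_C, AlgHom.commutes]
      rfl
    | add p q hp hq => simp only [map_add, hp, hq]
    | mul_X p k hp => simp only [map_mul, hp, mk_genericSection_genericPhi_C_X]
  | add p q hp hq => simp only [map_add, hp, hq]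
  | mul_X p i hp =>
    simp only [map_mul, hp, genericPhi_X]
    simp [genericSection]

theorem ker_genericPhi (A : Type*) [CommRing A] (n : ℕ) :
    RingHom.ker ((genericPhi A n) :
        MvPolynomial (Fin n) (MvPolynomial (Fin n) A) →+* MvPolynomial (Fin n) A)
      = splittingIdeal (MvPolynomial (Fin n) A) n (fun k : Fin n => X k) := by
  refine le_antisymm (fun p hp => ?_) (Ideal.span_le.2 ?_)
  · have hp' : genericPhi A n p = 0 := hp
    rw [← Ideal.Quotient.eq_zero_iff_mem, ← mk_genericSection_genericPhi, hp', map_zero, map_zero]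
  · rintro _ ⟨k, rfl⟩
    change genericPhi A n _ = 0
    rw [map_sub, genericPhi_esymm, genericPhi_C, map_mul, aeval_X, map_pow, map_neg, map_one,
      neg_one_pow_mul_neg_one_pow_mul, sub_self]

/-- `Φ` is surjective with kernel `J_g`; consequently it induces an `A`-algebra
isomorphism from the generic splitting algebra `B_g` onto the polynomial ring
`MvPolynomial (Fin n) A`, sending each universal root of `g` to the corresponding variable. -/
theorem generic_splittingAlg_iso_polynomialRing (A : Type*) [CommRing A] (n : ℕ) (hn : 1 ≤ n) :
    Function.Surjective (genericPhi A n) ∧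
    RingHom.ker ((genericPhi A n) :
        MvPolynomial (Fin n) (MvPolynomial (Fin n) A) →+* MvPolynomial (Fin n) A)
      = splittingIdeal (MvPolynomial (Fin n) A) n (fun k : Fin n => X k) ∧
    ∃ e : SplittingAlg (MvPolynomial (Fin n) A) n (fun k : Fin n => X k)
        ≃ₐ[A] MvPolynomial (Fin n) A,
      (∀ p : MvPolynomial (Fin n) (MvPolynomial (Fin n) A),
        e (splittingMk (MvPolynomial (Fin n) A) n (fun k : Fin n => X k) p)
          = genericPhi A n p) ∧
      (∀ i : Fin n, e (tau (MvPolynomial (Fin n) A) n (fun k : Fin n => X k) i) = X i) := by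
  have hsurj : Function.Surjective (genericPhi A n) :=
    fun p => ⟨genericSection A n p, genericPhi_genericSection A n p⟩
  have hker := ker_genericPhi A n
  refine ⟨hsurj, hker, (Ideal.quotientEquivAlgOfEq A hker.symm).trans
    (Ideal.quotientKerAlgEquivOfSurjective hsurj), fun p => rfl, fun i => ?_⟩
  exact genericPhi_X A n i
end

section
/- Let B be a commutative A-algebra and ν : Fin n → B a family of elements such that the image of f under the map A[X] → B[X] induced by algebraMap A B equals ∏_{i : Fin n} (X − C(ν i)). Then there exists a unique A-algebra homomorphism ψ : A_f → B satisfying ψ(τ_i) = ν_i for all i : Fin n. -/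
open MvPolynomial

/-- The monic polynomial `f = Xⁿ + a₁Xⁿ⁻¹ + ⋯ + aₙ` associated to the coefficients `a`. -/
noncomputable def assocPoly (A : Type*) [CommRing A] (n : ℕ) (a : Fin n → A) : Polynomial A :=
  Polynomial.X ^ n + ∑ k : Fin n, Polynomial.C (a k) * Polynomial.X ^ (n - (k.1 + 1))

theorem assocPoly_coeff (A : Type*) [CommRing A] (n : ℕ) (a : Fin n → A) (k : Fin n) :
    (assocPoly A n a).coeff (n - (k.1 + 1)) = a k := by
  have hk := k.isLt
  rw [assocPoly, Polynomial.coeff_add, Polynomial.coeff_X_pow, if_neg (by omega), zero_add,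
    Polynomial.finsetSum_coeff, Finset.sum_eq_single k]
  · simp
  · intro j _ hjk
    have hj := j.isLt
    rw [Polynomial.coeff_C_mul_X_pow, if_neg]
    intro h
    exact hjk (Fin.ext (by omega))
  · simp

/-- Vieta's formula for the roots of a split `assocPoly`. -/
theorem aeval_esymm_of_assocPoly_map_eq_prod {A : Type*} [CommRing A] {n : ℕ} {a : Fin n → A}
    {B : Type*} [CommRing B] [Algebra A B] {ν : Fin n → B}
    (hsplit : (assocPoly A n a).map (algebraMap A B)
      = ∏ i : Fin n, (Polynomial.X - Polynomial.C (ν i))) (k : Fin n) :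
    aeval ν (esymm (Fin n) A (k.1 + 1)) = algebraMap A B ((-1) ^ (k.1 + 1) * a k) := by
  have hcard : Multiset.card (Finset.univ.val.map ν) = n := by simp
  have hcoeff := Multiset.prod_X_sub_C_coeff (Finset.univ.val.map ν)
    (k := n - (k.1 + 1)) (by rw [hcard]; exact Nat.sub_le _ _)
  have hprod : ((Finset.univ.val.map ν).map fun t => Polynomial.X - Polynomial.C t).prod
      = (assocPoly A n a).map (algebraMap A B) := by
    rw [hsplit, Multiset.map_map]
    rfl
  rw [hprod, hcard, Nat.sub_sub_self k.isLt, Polynomial.coeff_map, assocPoly_coeff] at hcoeff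
  rw [aeval_esymm_eq_multiset_esymm, map_mul, hcoeff, map_pow, map_neg, map_one, ← mul_assoc,
    ← mul_pow, neg_one_mul, neg_neg, one_pow, one_mul]

/-- universal property of the splitting algebra: if `f` splits in an `A`-algebra
`B` with roots `ν i`, there exists a unique `A`-algebra homomorphism `ψ : A_f → B` with
`ψ τᵢ = νᵢ`. -/
theorem splittingAlg_universal_property (A : Type*) [CommRing A] (n : ℕ) (hn : 1 ≤ n)
    (a : Fin n → A) (B : Type*) [CommRing B] [Algebra A B] (ν : Fin n → B)
    (hsplit : (assocPoly A n a).map (algebraMap A B)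
      = ∏ i : Fin n, (Polynomial.X - Polynomial.C (ν i))) :
    ∃! ψ : SplittingAlg A n a →ₐ[A] B, ∀ i : Fin n, ψ (tau A n a i) = ν i := by
  have hker : ∀ p ∈ splittingIdeal A n a, (aeval ν : MvPolynomial (Fin n) A →ₐ[A] B) p = 0 := by
    intro p hp
    have hle : splittingIdeal A n a ≤
        RingHom.ker (aeval ν : MvPolynomial (Fin n) A →ₐ[A] B) := by
      refine Ideal.span_le.2 ?_
      rintro _ ⟨k, rfl⟩
      rw [SetLike.mem_coe, RingHom.mem_ker, map_sub,
        aeval_esymm_of_assocPoly_map_eq_prod hsplit, aeval_C, sub_self]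
    exact hle hp
  refine ⟨Ideal.Quotient.liftₐ (splittingIdeal A n a) (aeval ν) hker, fun i => ?_, ?_⟩
  · exact aeval_X ν i
  · intro ψ hψ
    refine Ideal.Quotient.algHom_ext A (MvPolynomial.algHom_ext fun i => ?_)
    exact (hψ i).trans (aeval_X ν i).symm
end

section
/- The element D_f := ∏_{i<j in Fin n} (τ_i + τ_j) of A_f lies in the image of algebraMap A A_f. -/
open MvPolynomial

/-- A product of a symmetric function over the ordered pairs `i < j` is invariant under
permutations. -/
theorem prod_lt_comp_perm {ι M : Type*} [Fintype ι] [LinearOrder ι] [CommMonoid M]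
    (f : ι → ι → M) (hf : ∀ i j, f i j = f j i) (σ : Equiv.Perm ι) :
    ∏ p ∈ Finset.univ.filter (fun p : ι × ι => p.1 < p.2), f (σ p.1) (σ p.2) =
      ∏ p ∈ Finset.univ.filter (fun p : ι × ι => p.1 < p.2), f p.1 p.2 := by
  let g (τ : Equiv.Perm ι) (p : ι × ι) : ι × ι :=
    if τ p.1 < τ p.2 then (τ p.1, τ p.2) else (τ p.2, τ p.1)
  have g_mem (τ : Equiv.Perm ι) (p : ι × ι) (hp : p.1 < p.2) : (g τ p).1 < (g τ p).2 := by
    by_cases h : τ p.1 < τ p.2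
    · simp [g, h]
    · simpa [g, h] using lt_of_le_of_ne (not_lt.1 h) (τ.injective.ne hp.ne')
  have g_inv (τ : Equiv.Perm ι) (p : ι × ι) (hp : p.1 < p.2) : g τ.symm (g τ p) = p := by
    by_cases h : τ p.1 < τ p.2
    · simp [g, h, hp]
    · simp [g, h, hp.not_gt]
  refine Finset.prod_nbij' (g σ) (g σ.symm) ?_ ?_ ?_ ?_ ?_
  · simpa using fun i j => g_mem σ (i, j)
  · simpa using fun i j => g_mem σ.symm (i, j)
  · simpa using fun i j => g_inv σ (i, j)
  · simpa using fun i j => g_inv σ.symm (i, j)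
  · intro p _
    by_cases h : σ p.1 < σ p.2
    · simp [g, h]
    · simp [g, h, hf (σ p.1)]

/-- Symmetric polynomials become scalars in the splitting algebra. -/
theorem splittingMk_mem_range_algebraMap (A : Type*) [CommRing A] (n : ℕ) (a : Fin n → A)
    {p : MvPolynomial (Fin n) A} (hp : p.IsSymmetric) :
    splittingMk A n a p ∈ Set.range (algebraMap A (SplittingAlg A n a)) := by
  obtain ⟨q, hq⟩ := esymmAlgHom_surjective (σ := Fin n) A (Fintype.card_fin n).le ⟨p, hp⟩
  have hqp : aeval (fun k : Fin n => esymm (Fin n) A (k.1 + 1)) q = p := by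
    rw [← esymmAlgHom_apply, hq]
  refine ⟨aeval (fun k : Fin n => (-1) ^ (k.1 + 1) * a k) q, ?_⟩
  rw [← hqp, ← AlgHom.comp_apply, comp_aeval, ← aeval_algebraMap_apply]
  simp only [splittingMk_esymm, Function.comp_def]

/-- the element `D_f = ∏_{i<j} (τᵢ + τⱼ)` lies in the image of
`algebraMap A A_f`. -/
theorem Df_mem_range_algebraMap (A : Type*) [CommRing A] (n : ℕ) (hn : 1 ≤ n)
    (a : Fin n → A) :
    Df A n a ∈ Set.range (algebraMap A (SplittingAlg A n a)) := by
  have hsymm : (∏ p ∈ Finset.univ.filter (fun p : Fin n × Fin n => p.1 < p.2),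
      (X p.1 + X p.2 : MvPolynomial (Fin n) A)).IsSymmetric := by
    intro σ
    simp only [map_prod, map_add, rename_X]
    exact prod_lt_comp_perm (fun i j => X i + X j) (fun i j => add_comm _ _) σ
  simpa only [Df, tau, map_prod, map_add] using splittingMk_mem_range_algebraMap A n a hsymm
end
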